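/- arXiv:2505.24321 — 8 statements merged into one kernel-verified Lean document; each statement's English description precedes it below -/
import Mathlib

section
/- For every α ∈ (0,1] and every deterministic online algorithm for goods, there exists a goods instance with n = 2 agents having additive tri-valued valuation functions such that the final allocation A^t produced by the algorithm is not non-wasteful, or is neither α-EF1 nor α-MMS. In particular, no deterministic online algorithm can compute a non-wasteful allocation that guarantees α-EF1 or α-MMS for any constant α > 0, even for two agents with additive tri-valued valuations. -/
open Finset

namespace OnlineFair

/-- The valuation/cost profile restricted to the items `0, …, k` that have arrived
by the end of (0-indexed) round `k`: an online algorithm's decision at round `k`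
may depend only on this restriction. -/
def restrictVal {n : ℕ} (v : Fin n → Finset ℕ → ℝ) (k : ℕ) : Fin n → Finset ℕ → ℝ :=
  fun i S => v i (S ∩ Finset.range (k + 1))

/-- A deterministic online algorithm for goods with `n` agents: at each round it sees
only the valuations restricted to the arrived items, and either assigns the newly
arrived item to an agent or discards it (`none`). -/
abbrev GoodsAlg (n : ℕ) : Type := ℕ → (Fin n → Finset ℕ → ℝ) → Option (Fin n)

/-- The allocation produced by a goods algorithm after `k` rounds
(the arrived items are `0, …, k-1`; item `k-1` arrived in the last round). -/
def runGoods {n : ℕ} (alg : GoodsAlg n) (v : Fin n → Finset ℕ → ℝ) : ℕ → Fin n → Finset ℕ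
  | 0 => fun _ => ∅
  | k + 1 => fun i =>
      match alg k (restrictVal v k) with
      | some j => if i = j then insert k (runGoods alg v k i) else runGoods alg v k i
      | none => runGoods alg v k i

/-- A deterministic online algorithm for chores with `n` agents: every arriving chore
must be assigned to some agent, based only on the costs restricted to arrived chores. -/
abbrev ChoresAlg (n : ℕ) : Type := ℕ → (Fin n → Finset ℕ → ℝ) → Fin n

/-- The (complete) allocation produced by a chores algorithm after `k` rounds. -/
def runChores {n : ℕ} (alg : ChoresAlg n) (c : Fin n → Finset ℕ → ℝ) : ℕ → Fin n → Finset ℕ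
  | 0 => fun _ => ∅
  | k + 1 => fun i =>
      if i = alg k (restrictVal c k) then insert k (runChores alg c k i)
      else runChores alg c k i

/-- A normalized monotone (hence nonnegative) valuation / cost function. -/
def IsVal (v : Finset ℕ → ℝ) : Prop :=
  v ∅ = 0 ∧ ∀ S T : Finset ℕ, S ⊆ T → v S ≤ v T

/-- Additive set function. -/
def AdditiveVal (v : Finset ℕ → ℝ) : Prop :=
  ∀ S : Finset ℕ, v S = ∑ e ∈ S, v {e}

/-- Tri-valued singleton values: `v {e} ∈ {a, b, z}` with `0 < a ≤ b ≤ z`. -/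
def TriValuedVal (v : Finset ℕ → ℝ) : Prop :=
  ∃ a b z : ℝ, 0 < a ∧ a ≤ b ∧ b ≤ z ∧ ∀ e : ℕ, v {e} = a ∨ v {e} = b ∨ v {e} = z

/-- Bi-valued singleton values: `v {e} ∈ {a, b}` with `0 < a ≤ b`. -/
def BiValuedVal (v : Finset ℕ → ℝ) : Prop :=
  ∃ a b : ℝ, 0 < a ∧ a ≤ b ∧ ∀ e : ℕ, v {e} = a ∨ v {e} = b

/-- Binary singleton values: `v {e} ∈ {0, 1}`. -/
def BinaryVal (v : Finset ℕ → ℝ) : Prop :=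
  ∀ e : ℕ, v {e} = 0 ∨ v {e} = 1

def Submodular (v : Finset ℕ → ℝ) : Prop :=
  ∀ X Y : Finset ℕ, v (X ∪ Y) + v (X ∩ Y) ≤ v X + v Y

def Supermodular (v : Finset ℕ → ℝ) : Prop :=
  ∀ X Y : Finset ℕ, v X + v Y ≤ v (X ∪ Y) + v (X ∩ Y)

/-- Every marginal value `v (X ∪ {e}) - v X` lies in `{0, 1}`. -/
def BinaryMarginals (v : Finset ℕ → ℝ) : Prop :=
  ∀ (X : Finset ℕ) (e : ℕ), v (insert e X) = v X ∨ v (insert e X) = v X + 1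

/-- Submodular binary valuation (equivalently, a matroid rank function). -/
def SubmodularBinary (v : Finset ℕ → ℝ) : Prop :=
  IsVal v ∧ Submodular v ∧ BinaryMarginals v

/-- Supermodular binary cost function. -/
def SupermodularBinary (v : Finset ℕ → ℝ) : Prop :=
  IsVal v ∧ Supermodular v ∧ BinaryMarginals v

/-- `B` is an allocation of (part of) the item set `T`:
pairwise disjoint bundles of items from `T`. -/
def IsAlloc (n : ℕ) (T : Finset ℕ) (B : Fin n → Finset ℕ) : Prop :=
  (∀ i, B i ⊆ T) ∧ ∀ i j, i ≠ j → Disjoint (B i) (B j)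

/-- Every item of `T` is assigned to some agent. -/
def Complete (n : ℕ) (T : Finset ℕ) (A : Fin n → Finset ℕ) : Prop :=
  ∀ e ∈ T, ∃ i, e ∈ A i

/-- `B` is a partition of `T` into `n` (possibly empty) bundles. -/
def IsPartition (n : ℕ) (T : Finset ℕ) (B : Fin n → Finset ℕ) : Prop :=
  IsAlloc n T B ∧ Complete n T B

/-- Non-wastefulness of the allocation `A` of the arrived goods `T`:
every allocated good has strictly positive marginal value inside its bundle, and
every discarded good has zero marginal value with respect to every agent's bundle. -/
def NonWasteful (n : ℕ) (v : Fin n → Finset ℕ → ℝ) (T : Finset ℕ)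
    (A : Fin n → Finset ℕ) : Prop :=
  (∀ i, ∀ e ∈ A i, v i ((A i).erase e) < v i (A i)) ∧
  (∀ i, ∀ e ∈ T, (∀ j, e ∉ A j) → v i (insert e (A i)) = v i (A i))

/-- `α`-EF1 for goods. -/
def EF1Goods (n : ℕ) (α : ℝ) (v : Fin n → Finset ℕ → ℝ) (A : Fin n → Finset ℕ) : Prop :=
  ∀ i j : Fin n, (A j).Nonempty → ∃ e ∈ A j, α * v i ((A j).erase e) ≤ v i (A i)

/-- `α`-MMS for goods: for every `n`-partition `B` of the arrived items, agent `i`'s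
value is at least `α` times the minimum bundle value of `B` (i.e. at least `α` times
the value of some bundle of `B`); this says `v i (A i) ≥ α · MMS_i`. -/
def MMSGoods (n : ℕ) (α : ℝ) (v : Fin n → Finset ℕ → ℝ) (T : Finset ℕ)
    (A : Fin n → Finset ℕ) : Prop :=
  ∀ i : Fin n, ∀ B : Fin n → Finset ℕ, IsPartition n T B → ∃ j, α * v i (B j) ≤ v i (A i)

/-- `α`-max-USW: the utilitarian social welfare of `A` is at least `α` times that of
any allocation of the arrived items. -/
def MaxUSW (n : ℕ) (α : ℝ) (v : Fin n → Finset ℕ → ℝ) (T : Finset ℕ)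
    (A : Fin n → Finset ℕ) : Prop :=
  ∀ B : Fin n → Finset ℕ, IsAlloc n T B → α * ∑ i, v i (B i) ≤ ∑ i, v i (A i)

/-- `α`-EF1 for chores. -/
def EF1Chores (n : ℕ) (α : ℝ) (c : Fin n → Finset ℕ → ℝ) (A : Fin n → Finset ℕ) : Prop :=
  ∀ i j : Fin n, (A i).Nonempty → ∃ e ∈ A i, c i ((A i).erase e) ≤ α * c i (A j)

/-- `α`-MMS (minimax share) for chores: for every `n`-partition `B` of the arrived
chores, agent `i`'s cost is at most `α` times the maximum bundle cost of `B`
(i.e. at most `α` times the cost of some bundle of `B`); this says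
`c i (A i) ≤ α · MMS_i`. -/
def MMSChores (n : ℕ) (α : ℝ) (c : Fin n → Finset ℕ → ℝ) (T : Finset ℕ)
    (A : Fin n → Finset ℕ) : Prop :=
  ∀ i : Fin n, ∀ B : Fin n → Finset ℕ, IsPartition n T B → ∃ j, c i (A i) ≤ α * c i (B j)

/-- `α`-min-USC: the utilitarian social cost of `A` is at most `α` times that of any
complete allocation of the arrived chores. -/
def MinUSC (n : ℕ) (α : ℝ) (c : Fin n → Finset ℕ → ℝ) (T : Finset ℕ)
    (A : Fin n → Finset ℕ) : Prop :=
  ∀ B : Fin n → Finset ℕ, IsPartition n T B → ∑ i, c i (A i) ≤ α * ∑ i, c i (B i)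

/-- The additive set function with item weights `w`. -/
noncomputable def sumVal (w : ℕ → ℝ) (S : Finset ℕ) : ℝ := ∑ e ∈ S, w e

theorem additiveVal_sumVal (w : ℕ → ℝ) : AdditiveVal (sumVal w) := fun S => by
  simp [sumVal]

theorem runGoods_succ_of_eq_some {n : ℕ} {alg : GoodsAlg n} {v : Fin n → Finset ℕ → ℝ}
    {k : ℕ} {j : Fin n} (h : alg k (restrictVal v k) = some j) (i : Fin n) :
    runGoods alg v (k + 1) i =
      if i = j then insert k (runGoods alg v k i) else runGoods alg v k i := by
  simp [runGoods, h]

theorem runGoods_succ_of_eq_none {n : ℕ} {alg : GoodsAlg n} {v : Fin n → Finset ℕ → ℝ}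
    {k : ℕ} (h : alg k (restrictVal v k) = none) (i : Fin n) :
    runGoods alg v (k + 1) i = runGoods alg v k i := by
  simp [runGoods, h]

theorem runGoods_subset_range {n : ℕ} (alg : GoodsAlg n) (v : Fin n → Finset ℕ → ℝ)
    (k : ℕ) (i : Fin n) : runGoods alg v k i ⊆ range k := by
  induction k with
  | zero => simp [runGoods]
  | succ k ih =>
    have ih' : runGoods alg v k i ⊆ range (k + 1) := ih.trans (range_mono k.le_succ)
    cases h : alg k (restrictVal v k) with
    | none => rwa [runGoods_succ_of_eq_none h]
    | some j =>
      rw [runGoods_succ_of_eq_some h]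
      split_ifs
      · exact insert_subset (self_mem_range_succ k) ih'
      · exact ih'

/-- Discarding the last good is wasteful when some agent values it positively. -/
theorem not_nonWasteful_of_discard {n : ℕ} {alg : GoodsAlg n} {w : Fin n → ℕ → ℝ} {k : ℕ}
    (h : alg k (restrictVal (fun i => sumVal (w i)) k) = none) (i : Fin n) (hi : 0 < w i k) :
    ¬ NonWasteful n (fun i => sumVal (w i)) (range (k + 1))
      (runGoods alg (fun i => sumVal (w i)) (k + 1)) := by
  rintro ⟨-, hdisc⟩
  have hk : ∀ j, k ∉ runGoods alg (fun i => sumVal (w i)) (k + 1) j := fun j hj => by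
    rw [runGoods_succ_of_eq_none h] at hj
    simpa using runGoods_subset_range _ _ _ _ hj
  have := hdisc i k (self_mem_range_succ k) hk
  simp only [sumVal] at this
  rw [sum_insert (hk i)] at this
  linarith

/-- If agent `i` envies agent `j` beyond one good, and some set `S` and its complement are both
much better for `i` than her bundle, the allocation is neither `α`-EF1 nor `α`-MMS. -/
theorem not_EF1Goods_or_MMSGoods {α : ℝ} {v : Fin 2 → Finset ℕ → ℝ} {A : Fin 2 → Finset ℕ}
    {T : Finset ℕ} (i j : Fin 2) (hne : (A j).Nonempty)
    (henvy : ∀ e ∈ A j, v i (A i) < α * v i ((A j).erase e))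
    (S : Finset ℕ) (hST : S ⊆ T) (hS : v i (A i) < α * v i S)
    (hS' : v i (A i) < α * v i (T \ S)) :
    ¬ (EF1Goods 2 α v A ∨ MMSGoods 2 α v T A) := by
  rintro (h | h)
  · obtain ⟨e, he, hle⟩ := h i j hne
    exact (henvy e he).not_ge hle
  · have hpart : IsPartition 2 T ![S, T \ S] := by
      refine ⟨⟨?_, ?_⟩, ?_⟩
      · simp [Fin.forall_fin_two, hST]
      · simp [Fin.forall_fin_two, disjoint_sdiff, sdiff_disjoint]
      · intro e he
        simp only [Fin.exists_fin_two, Matrix.cons_val_zero, Matrix.cons_val_one, mem_sdiff]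
        tauto
    obtain ⟨k, hk⟩ := h i _ hpart
    fin_cases k
    · exact hS.not_ge hk
    · exact hS'.not_ge hk

/-- Item weights of the adversarial instance: agent `p` finds goods `1` and `2` much more
valuable than good `0`, while for the other agent good `1` is almost worthless. -/
noncomputable def adversaryWeight (α : ℝ) (p i : Fin 2) (e : ℕ) : ℝ :=
  if i = p then (if e = 1 ∨ e = 2 then 2 / α else 1) else (if e = 1 then α / 2 else 1)

theorem adversaryWeight_pos {α : ℝ} (hα : 0 < α) (p i : Fin 2) (e : ℕ) :
    0 < adversaryWeight α p i e := by
  unfold adversaryWeight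
  split_ifs <;> positivity

theorem triValuedVal_adversaryWeight {α : ℝ} (hα : 0 < α) (hα1 : α ≤ 1) (p i : Fin 2) :
    TriValuedVal (sumVal (adversaryWeight α p i)) := by
  refine ⟨α / 2, 1, 2 / α, by positivity, by linarith, ?_, fun e => ?_⟩
  · rw [le_div_iff₀ hα]
    linarith
  · simp only [sumVal, sum_singleton, adversaryWeight]
    split_ifs <;> simp

/-- After the first round the adversarial instance does not yet depend on `p`. -/
theorem restrictVal_adversaryWeight_zero (α : ℝ) (p p' : Fin 2) :
    restrictVal (fun i => sumVal (adversaryWeight α p i)) 0 =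
      restrictVal (fun i => sumVal (adversaryWeight α p' i)) 0 := by
  funext i S
  refine sum_congr rfl fun e he => ?_
  obtain rfl : e = 0 := by simpa using (mem_inter.1 he).2
  simp [adversaryWeight]

/-- On the adversarial instance, an algorithm giving good `0` to agent `p` fails. -/
theorem exists_unfair_of_first_good {α : ℝ} (hα : 0 < α) (alg : GoodsAlg 2) (p : Fin 2)
    (h0 : alg 0 (restrictVal (fun i => sumVal (adversaryWeight α p i)) 0) = some p) :
    ∃ t, ¬ (NonWasteful 2 (fun i => sumVal (adversaryWeight α p i)) (range t)
          (runGoods alg (fun i => sumVal (adversaryWeight α p i)) t) ∧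
        (EF1Goods 2 α (fun i => sumVal (adversaryWeight α p i))
            (runGoods alg (fun i => sumVal (adversaryWeight α p i)) t) ∨
          MMSGoods 2 α (fun i => sumVal (adversaryWeight α p i)) (range t)
            (runGoods alg (fun i => sumVal (adversaryWeight α p i)) t))) := by
  have hpos := adversaryWeight_pos hα p p
  obtain ⟨q, hqp⟩ := exists_ne p
  have hq : ∀ r, r ≠ p → r = q := by grind
  set v : Fin 2 → Finset ℕ → ℝ := fun i => sumVal (adversaryWeight α p i) with hv
  have hvp (S : Finset ℕ) : v p S = ∑ e ∈ S, if e = 1 ∨ e = 2 then 2 / α else 1 := by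
    simp [hv, sumVal, adversaryWeight]
  have hvq (S : Finset ℕ) : v q S = ∑ e ∈ S, if e = 1 then α / 2 else 1 := by
    simp [hv, sumVal, adversaryWeight, hqp]
  have hK : α * (2 / α) = 2 := by field_simp
  have e01 : ({0, 1} : Finset ℕ).erase 0 = {1} := by decide
  have e10 : ({0, 1} : Finset ℕ).erase 1 = {0} := by decide
  have e02 : ({0, 2} : Finset ℕ).erase 0 = {2} := by decide
  have e20 : ({0, 2} : Finset ℕ).erase 2 = {0} := by decide
  have e12 : ({1, 2} : Finset ℕ).erase 1 = {2} := by decide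
  have e21 : ({1, 2} : Finset ℕ).erase 2 = {1} := by decide
  have c2 : range 2 \ {0} = {1} := by decide
  have c3 : range 3 \ {2} = {0, 1} := by decide
  have hp1 : runGoods alg v 1 p = {0} := by
    rw [runGoods_succ_of_eq_some h0, if_pos rfl]; rfl
  have hq1 : runGoods alg v 1 q = ∅ := by
    rw [runGoods_succ_of_eq_some h0, if_neg hqp]; rfl
  cases h1 : alg 1 (restrictVal v 1) with
  | none => exact ⟨2, fun h => not_nonWasteful_of_discard h1 p (hpos 1) h.1⟩
  | some r =>
  by_cases hr : r = p
  · subst hr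
    have hp2 : runGoods alg v 2 r = {0, 1} := by
      rw [runGoods_succ_of_eq_some h1, if_pos rfl, hp1]; decide
    have hq2 : runGoods alg v 2 q = ∅ := by
      rw [runGoods_succ_of_eq_some h1, if_neg hqp, hq1]
    refine ⟨2, fun h => not_EF1Goods_or_MMSGoods q r ?_ ?_ {0} ?_ ?_ ?_ h.2⟩
    · simp [hp2]
    · simp [hp2, hq2, hvq, e01, e10, hα]
    · decide
    · simp [hq2, hvq, hα]
    · simp [hq2, hvq, c2, hα]
  obtain rfl := hq r hr
  have hp2 : runGoods alg v 2 p = {0} := by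
    rw [runGoods_succ_of_eq_some h1, if_neg hqp.symm, hp1]
  have hq2 : runGoods alg v 2 r = {1} := by
    rw [runGoods_succ_of_eq_some h1, if_pos rfl, hq1]; rfl
  cases h2 : alg 2 (restrictVal v 2) with
  | none => exact ⟨3, fun h => not_nonWasteful_of_discard h2 p (hpos 2) h.1⟩
  | some s =>
  by_cases hs : s = p
  · subst hs
    have hp3 : runGoods alg v 3 s = {0, 2} := by
      rw [runGoods_succ_of_eq_some h2, if_pos rfl, hp2]; decide
    have hq3 : runGoods alg v 3 r = {1} := by
      rw [runGoods_succ_of_eq_some h2, if_neg hqp, hq2]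
    refine ⟨3, fun h => not_EF1Goods_or_MMSGoods r s ?_ ?_ {2} ?_ ?_ ?_ h.2⟩
    · simp [hp3]
    · simp [hp3, hq3, hvq, e02, e20, hα]
    · decide
    · simp [hq3, hvq, hα]
    · simp [hq3, hvq, c3]
      nlinarith
  · obtain rfl := hq s hs
    have hp3 : runGoods alg v 3 p = {0} := by
      rw [runGoods_succ_of_eq_some h2, if_neg hqp.symm, hp2]
    have hq3 : runGoods alg v 3 s = {1, 2} := by
      rw [runGoods_succ_of_eq_some h2, if_pos rfl, hq2]; decide
    refine ⟨3, fun h => not_EF1Goods_or_MMSGoods p s ?_ ?_ {2} ?_ ?_ ?_ h.2⟩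
    · simp [hq3]
    · simp [hp3, hq3, hvp, e12, e21, hK]
    · decide
    · simp [hp3, hvp, hK]
    · simp [hp3, hvp, c3, mul_add, hK]
      linarith

/-- for additive tri-valued valuations and two agents, no deterministic
online goods algorithm guarantees a non-wasteful allocation that is `α`-EF1 or
`α`-MMS, for any `α ∈ (0,1]`. -/
theorem goods_triValued_no_EF1_or_MMS :
    ∀ α : ℝ, 0 < α → α ≤ 1 →
    ∀ alg : GoodsAlg 2,
    ∃ (t : ℕ) (v : Fin 2 → Finset ℕ → ℝ),
      (∀ i, AdditiveVal (v i)) ∧ (∀ i, TriValuedVal (v i)) ∧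
      ¬ (NonWasteful 2 v (Finset.range t) (runGoods alg v t) ∧
          (EF1Goods 2 α v (runGoods alg v t) ∨
            MMSGoods 2 α v (Finset.range t) (runGoods alg v t))) := by
  intro α hα hα1 alg
  cases h0 : alg 0 (restrictVal (fun i => sumVal (adversaryWeight α 0 i)) 0) with
  | none =>
    exact ⟨1, fun i => sumVal (adversaryWeight α 0 i), fun i => additiveVal_sumVal _,
      fun i => triValuedVal_adversaryWeight hα hα1 0 i,
      fun h => not_nonWasteful_of_discard h0 0 (adversaryWeight_pos hα 0 0 0) h.1⟩
  | some p =>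
    rw [restrictVal_adversaryWeight_zero α 0 p] at h0
    obtain ⟨t, ht⟩ := exists_unfair_of_first_good hα alg p h0
    exact ⟨t, _, fun i => additiveVal_sumVal _,
      fun i => triValuedVal_adversaryWeight hα hα1 p i, ht⟩

end OnlineFair
end

section
/- There exists a deterministic online algorithm for goods such that, for every goods instance in which all n agents have submodular binary valuation functions and for every round k, the allocation A^k it produces is non-wasteful, (1/2)-EF1, (1/2)-MMS, and (1/2)-max-USW. -/
open Finset

namespace OnlineFair

section SubmodularBinaryLemmas

variable {v : Finset ℕ → ℝ}

theorem SubmodularBinary.mono (hv : SubmodularBinary v) {S T : Finset ℕ} (h : S ⊆ T) :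
    v S ≤ v T :=
  hv.1.2 S T h

theorem SubmodularBinary.insert_le (hv : SubmodularBinary v) (S : Finset ℕ) (e : ℕ) :
    v (insert e S) ≤ v S + 1 := by
  rcases hv.2.2 S e with h | h <;> linarith

theorem SubmodularBinary.le_card (hv : SubmodularBinary v) (S : Finset ℕ) : v S ≤ #S := by
  induction S using Finset.induction_on with
  | empty => simp [hv.1.1]
  | insert e S he ih =>
    rw [card_insert_of_notMem he]
    push_cast
    linarith [hv.insert_le S e]

/-- Marginal values are decreasing. -/
theorem SubmodularBinary.marginal_anti (hv : SubmodularBinary v) {X Y : Finset ℕ} (h : X ⊆ Y)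
    (e : ℕ) : v (insert e Y) - v Y ≤ v (insert e X) - v X := by
  by_cases he : e ∈ Y
  · rw [insert_eq_of_mem he]
    linarith [hv.mono (subset_insert e X)]
  · have h1 := hv.2.1 (insert e X) Y
    rw [insert_union, union_eq_right.2 h, insert_inter_of_notMem he, inter_eq_left.2 h] at h1
    linarith

/-- The items of `S` having positive marginal value with respect to `A`. -/
noncomputable def useful (v : Finset ℕ → ℝ) (A S : Finset ℕ) : Finset ℕ :=
  S.filter fun e => v A < v (insert e A)

theorem mem_useful {A S : Finset ℕ} {e : ℕ} :
    e ∈ useful v A S ↔ e ∈ S ∧ v A < v (insert e A) := by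
  simp [useful]

theorem useful_subset (A S : Finset ℕ) : useful v A S ⊆ S :=
  filter_subset _ _

theorem useful_self (A : Finset ℕ) : useful v A A = ∅ := by
  ext e
  simp +contextual [mem_useful]

theorem SubmodularBinary.useful_anti (hv : SubmodularBinary v) {A A' : Finset ℕ} (h : A ⊆ A')
    (S : Finset ℕ) : useful v A' S ⊆ useful v A S := by
  intro e he
  rw [mem_useful] at he ⊢
  exact ⟨he.1, by linarith [hv.marginal_anti h e, he.2]⟩

theorem SubmodularBinary.union_le (hv : SubmodularBinary v) (A S : Finset ℕ) :
    v (A ∪ S) ≤ v A + #(useful v A S) := by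
  induction S using Finset.induction_on with
  | empty => simp [useful]
  | insert e S he ih =>
    rw [union_insert]
    by_cases hu : v A < v (insert e A)
    · have : useful v A (insert e S) = insert e (useful v A S) := by
        simp [useful, filter_insert, hu]
      rw [this, card_insert_of_notMem fun h => he (useful_subset _ _ h)]
      push_cast
      linarith [hv.insert_le (A ∪ S) e]
    · have : useful v A (insert e S) = useful v A S := by
        simp [useful, filter_insert, hu]
      rw [this]
      linarith [hv.marginal_anti (subset_union_left (s₁ := A) (s₂ := S)) e]

theorem SubmodularBinary.le_add_card_useful (hv : SubmodularBinary v) (A S : Finset ℕ) :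
    v S ≤ v A + #(useful v A S) :=
  (hv.mono subset_union_right).trans (hv.union_le A S)

end SubmodularBinaryLemmas

section Greedy

variable {n : ℕ}

/-- The agents for whom item `k` has positive marginal value. -/
noncomputable def demanders (v : Fin n → Finset ℕ → ℝ) (k : ℕ) (A : Fin n → Finset ℕ) :
    Finset (Fin n) :=
  univ.filter fun i => v i (A i) < v i (insert k (A i))

/-- An agent of `D` with a smallest bundle, if there is one. -/
noncomputable def pick (D : Finset (Fin n)) (A : Fin n → Finset ℕ) : Option (Fin n) :=
  if h : D.Nonempty then some (exists_min_image D (fun i => #(A i)) h).choose else none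

theorem pick_eq_none {D : Finset (Fin n)} {A : Fin n → Finset ℕ} (h : pick D A = none) :
    D = ∅ := by
  by_contra hD
  simp [pick, nonempty_iff_ne_empty.2 hD] at h

theorem pick_eq_some {D : Finset (Fin n)} {A : Fin n → Finset ℕ} {i : Fin n}
    (h : pick D A = some i) : i ∈ D ∧ ∀ j ∈ D, #(A i) ≤ #(A j) := by
  unfold pick at h
  split_ifs at h with hD
  obtain rfl := Option.some.inj h
  exact (exists_min_image D (fun i => #(A i)) hD).choose_spec

/-- Give item `k` to an agent who values it and has a smallest bundle among such agents. -/
noncomputable def greedyStep (v : Fin n → Finset ℕ → ℝ) (k : ℕ) (A : Fin n → Finset ℕ) :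
    Fin n → Finset ℕ := fun i =>
  match pick (demanders v k A) A with
  | some j => if i = j then insert k (A i) else A i
  | none => A i

noncomputable def greedy (v : Fin n → Finset ℕ → ℝ) : ℕ → Fin n → Finset ℕ
  | 0 => fun _ => ∅
  | k + 1 => greedyStep v k (greedy v k)

theorem greedyStep_none {v : Fin n → Finset ℕ → ℝ} {k : ℕ} {A : Fin n → Finset ℕ}
    (h : pick (demanders v k A) A = none) : greedyStep v k A = A := by
  funext i
  simp [greedyStep, h]

theorem greedyStep_some {v : Fin n → Finset ℕ → ℝ} {k : ℕ} {A : Fin n → Finset ℕ} {j : Fin n}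
    (h : pick (demanders v k A) A = some j) :
    greedyStep v k A = Function.update A j (insert k (A j)) := by
  funext i
  by_cases hi : i = j
  · subst hi
    simp [greedyStep, h]
  · simp [greedyStep, h, hi]

theorem greedy_subset (v : Fin n → Finset ℕ → ℝ) (k : ℕ) (i : Fin n) :
    greedy v k i ⊆ range k := by
  induction k with
  | zero => simp [greedy]
  | succ k ih =>
    have h1 : greedy v k i ⊆ range (k + 1) := ih.trans (range_subset_range.2 k.le_succ)
    simp only [greedy, greedyStep]
    split
    · split_ifs
      · exact insert_subset (by simp) h1
      · exact h1
    · exact h1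

theorem demanders_congr {v w : Fin n → Finset ℕ → ℝ} {k : ℕ} {A : Fin n → Finset ℕ}
    (hA : ∀ i, A i ⊆ range k) (h : ∀ i, ∀ S ⊆ range (k + 1), v i S = w i S) :
    demanders v k A = demanders w k A := by
  have h1 : ∀ i, A i ⊆ range (k + 1) := fun i => (hA i).trans (range_subset_range.2 k.le_succ)
  unfold demanders
  congr 1
  funext i
  rw [h i _ (h1 i), h i _ (insert_subset (by simp) (h1 i))]

theorem greedy_congr {v w : Fin n → Finset ℕ → ℝ} {k : ℕ}
    (h : ∀ i, ∀ S ⊆ range k, v i S = w i S) : greedy v k = greedy w k := by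
  induction k with
  | zero => rfl
  | succ k ih =>
    have h1 := ih fun i S hS => h i S (hS.trans (range_subset_range.2 k.le_succ))
    funext i
    simp only [greedy, greedyStep, h1, demanders_congr (greedy_subset w k) h]

theorem restrictVal_apply (v : Fin n → Finset ℕ → ℝ) {k : ℕ} (i : Fin n) {S : Finset ℕ}
    (hS : S ⊆ range (k + 1)) : restrictVal v k i S = v i S := by
  rw [restrictVal, inter_eq_left.2 hS]

/-- The greedy rule as an online algorithm: it recomputes the current allocation. -/
noncomputable def greedyAlg (n : ℕ) : GoodsAlg n := fun k w =>
  pick (demanders w k (greedy w k)) (greedy w k)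

theorem runGoods_greedyAlg (v : Fin n → Finset ℕ → ℝ) (k : ℕ) :
    runGoods (greedyAlg n) v k = greedy v k := by
  induction k with
  | zero => rfl
  | succ k ih =>
    have h1 : greedy (restrictVal v k) k = greedy v k := greedy_congr fun i S hS =>
      restrictVal_apply v i (hS.trans (range_subset_range.2 k.le_succ))
    have h2 : demanders (restrictVal v k) k (greedy v k) = demanders v k (greedy v k) :=
      demanders_congr (greedy_subset v k) fun i S hS => restrictVal_apply v i hS
    funext i
    simp only [runGoods, greedy, greedyStep, ih, greedyAlg, h1, h2]

/-- The properties of an allocation of the items `0, …, k - 1` that the greedy rule preserves. -/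
structure Balanced (v : Fin n → Finset ℕ → ℝ) (k : ℕ) (A : Fin n → Finset ℕ) : Prop where
  isAlloc : IsAlloc n (range k) A
  val_eq : ∀ i, v i (A i) = #(A i)
  discarded : ∀ i, ∀ e ∈ range k, (∀ j, e ∉ A j) → ¬ v i (A i) < v i (insert e (A i))
  card_useful : ∀ i j, #(useful (v i) (A i) (A j)) ≤ #(A i) + 1

variable {v : Fin n → Finset ℕ → ℝ} {k : ℕ} {A : Fin n → Finset ℕ}

theorem Balanced.greedyStep (hv : ∀ i, SubmodularBinary (v i)) (h : Balanced v k A) :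
    Balanced v (k + 1) (greedyStep v k A) := by
  have hr : range k ⊆ range (k + 1) := range_subset_range.2 k.le_succ
  have hk : ∀ i, k ∉ A i := fun i hi => by simpa using h.isAlloc.1 i hi
  rcases hp : pick (demanders v k A) A with _ | a
  · rw [greedyStep_none hp]
    refine ⟨⟨fun i => (h.isAlloc.1 i).trans hr, h.isAlloc.2⟩, h.val_eq, ?_, h.card_useful⟩
    intro i e he hd
    rcases eq_or_ne e k with rfl | hne
    · intro hlt
      have : i ∈ demanders v e A := by simpa [demanders] using hlt
      simp [pick_eq_none hp] at this
    · exact h.discarded i e (by simp at he ⊢; omega) hd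
  · obtain ⟨hmem, hmin⟩ := pick_eq_some hp
    rw [greedyStep_some hp]
    set A' := Function.update A a (insert k (A a)) with hA'
    have haa : A' a = insert k (A a) := by simp [hA']
    have hne : ∀ i, i ≠ a → A' i = A i := fun i hi => by simp [hA', hi]
    have hsub : ∀ i, A i ⊆ A' i := by
      intro i
      rcases eq_or_ne i a with rfl | hi
      · rw [haa]; exact subset_insert _ _
      · rw [hne i hi]
    have hlt : v a (A a) < v a (insert k (A a)) := by simpa [demanders] using hmem
    refine ⟨⟨fun i => ?_, ?_⟩, fun i => ?_, ?_, fun i j => ?_⟩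
    · rcases eq_or_ne i a with rfl | hi
      · rw [haa]
        exact insert_subset (by simp) ((h.isAlloc.1 i).trans hr)
      · rw [hne i hi]
        exact (h.isAlloc.1 i).trans hr
    · intro i j hij
      rcases eq_or_ne i a with rfl | hi
      · rw [haa, hne j hij.symm, disjoint_insert_left]
        exact ⟨hk j, h.isAlloc.2 i j hij⟩
      · rw [hne i hi]
        rcases eq_or_ne j a with rfl | hj
        · rw [haa, disjoint_insert_right]
          exact ⟨hk i, h.isAlloc.2 i j hij⟩
        · rw [hne j hj]
          exact h.isAlloc.2 i j hij
    · rcases eq_or_ne i a with rfl | hi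
      · rw [haa, card_insert_of_notMem (hk i)]
        push_cast
        rw [← h.val_eq i]
        rcases (hv i).2.2 (A i) k with h1 | h1
        · exact absurd h1 hlt.ne'
        · exact h1
      · rw [hne i hi]
        exact h.val_eq i
    · intro i e he hd hcon
      rcases eq_or_ne e k with rfl | hek
      · exact hd a (by simp [haa])
      · refine h.discarded i e (by simp at he ⊢; omega) (fun j hj => hd j (hsub j hj)) ?_
        linarith [(hv i).marginal_anti (hsub i) e]
    · have hanti := card_le_card ((hv i).useful_anti (hsub i) (A' j))
      have hcard := card_le_card (hsub i)
      rcases eq_or_ne j a with rfl | hj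
      · by_cases hi : v i (A i) < v i (insert k (A i))
        · have h1 : #(A j) ≤ #(A i) := hmin i (by simpa [demanders] using hi)
          have h2 := card_le_card (useful_subset (v := v i) (A i) (A' j))
          rw [haa, card_insert_of_notMem (hk j)] at h2
          rw [haa] at hanti ⊢
          omega
        · have h1 : useful (v i) (A i) (A' j) = useful (v i) (A i) (A j) := by
            simp [haa, useful, filter_insert, hi]
          rw [h1] at hanti
          have := h.card_useful i j
          omega
      · rw [hne j hj] at hanti ⊢
        have := h.card_useful i j
        omega

theorem balanced_greedy (hv : ∀ i, SubmodularBinary (v i)) (k : ℕ) :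
    Balanced v k (greedy v k) := by
  induction k with
  | zero =>
    refine ⟨⟨?_, ?_⟩, ?_, ?_, ?_⟩ <;> simp [greedy, (hv _).1.1, useful]
  | succ k ih => exact ih.greedyStep hv

theorem Balanced.useful_subset_biUnion (h : Balanced v k A) (i : Fin n) {S : Finset ℕ}
    (hS : S ⊆ range k) :
    useful (v i) (A i) S ⊆ univ.biUnion A := by
  intro e he
  rw [mem_useful] at he
  by_contra hd
  exact h.discarded i e (hS he.1) (by simpa using hd) he.2

theorem Balanced.nonWasteful (hv : ∀ i, SubmodularBinary (v i)) (h : Balanced v k A) :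
    NonWasteful n v (range k) A := by
  refine ⟨fun i e he => ?_, fun i e he hd => ?_⟩
  · have h1 := (hv i).le_card ((A i).erase e)
    have h2 : (#((A i).erase e) : ℝ) + 1 = #(A i) := by
      exact_mod_cast card_erase_add_one he
    rw [h.val_eq i]
    linarith
  · exact le_antisymm (not_lt.1 (h.discarded i e he hd)) ((hv i).mono (subset_insert _ _))

theorem Balanced.ef1Goods (hv : ∀ i, SubmodularBinary (v i)) (h : Balanced v k A) :
    EF1Goods n (1 / 2) v A := by
  intro i j hj
  have key : ∃ e ∈ A j, #(useful (v i) (A i) ((A j).erase e)) ≤ #(A i) := by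
    have hsub : ∀ e, useful (v i) (A i) ((A j).erase e) = (useful (v i) (A i) (A j)).erase e :=
      fun e => by simp [useful, filter_erase]
    rcases (useful (v i) (A i) (A j)).eq_empty_or_nonempty with hU | ⟨e, he⟩
    · obtain ⟨e, he⟩ := hj
      exact ⟨e, he, by simp [hsub, hU]⟩
    · refine ⟨e, useful_subset _ _ he, ?_⟩
      rw [hsub, card_erase_of_mem he]
      have := h.card_useful i j
      omega
  obtain ⟨e, he, hle⟩ := key
  refine ⟨e, he, ?_⟩
  have h1 := (hv i).le_add_card_useful (A i) ((A j).erase e)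
  have h2 : (#(useful (v i) (A i) ((A j).erase e)) : ℝ) ≤ #(A i) := by exact_mod_cast hle
  linarith [h.val_eq i]

theorem Balanced.mmsGoods (hv : ∀ i, SubmodularBinary (v i)) (h : Balanced v k A) :
    MMSGoods n (1 / 2) v (range k) A := by
  intro i B hB
  by_contra! hcon
  have hlow : ∀ j, #(A i) + 1 ≤ #(useful (v i) (A i) (B j)) := by
    intro j
    have h1 := (hv i).le_add_card_useful (A i) (B j)
    have h2 := hcon j
    rw [h.val_eq i] at h1 h2
    have : (#(A i) : ℝ) < #(useful (v i) (A i) (B j)) := by linarith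
    exact_mod_cast this
  have hdisj : ∑ j, #(useful (v i) (A i) (B j)) ≤ #(useful (v i) (A i) (range k)) := by
    rw [← card_biUnion fun j _ l _ hjl => (hB.1.2 j l hjl).mono (useful_subset _ _)
      (useful_subset _ _)]
    refine card_le_card (biUnion_subset.2 fun j _ => filter_subset_filter _ (hB.1.1 j))
  have hcover : #(useful (v i) (A i) (range k)) ≤ ∑ j, #(useful (v i) (A i) (A j)) := by
    refine (card_le_card fun e he => ?_).trans card_biUnion_le
    obtain ⟨j, -, hj⟩ := mem_biUnion.1 (h.useful_subset_biUnion i subset_rfl he)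
    exact mem_biUnion.2 ⟨j, mem_univ j, mem_useful.2 ⟨hj, (mem_useful.1 he).2⟩⟩
  have hlt : ∑ j, #(useful (v i) (A i) (A j)) < ∑ _j : Fin n, (#(A i) + 1) :=
    sum_lt_sum (fun j _ => h.card_useful i j) ⟨i, mem_univ i, by simp [useful_self]⟩
  have hge := sum_le_sum fun j (_ : j ∈ univ) => hlow j
  omega

theorem Balanced.maxUSW (hv : ∀ i, SubmodularBinary (v i)) (h : Balanced v k A) :
    MaxUSW n (1 / 2) v (range k) A := by
  intro B hB
  have hcard : ∑ i, #(useful (v i) (A i) (B i)) ≤ ∑ i, #(A i) := by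
    rw [← card_biUnion fun i _ j _ hij => (hB.2 i j hij).mono (useful_subset _ _)
      (useful_subset _ _)]
    exact (card_le_card (biUnion_subset.2 fun i _ =>
      h.useful_subset_biUnion i (hB.1 i))).trans card_biUnion_le
  have h1 : ∑ i, (#(useful (v i) (A i) (B i)) : ℝ) ≤ ∑ i, v i (A i) := by
    simp only [h.val_eq]
    exact_mod_cast hcard
  have h2 : ∑ i, v i (B i) ≤ ∑ i, (v i (A i) + #(useful (v i) (A i) (B i))) :=
    sum_le_sum fun i _ => (hv i).le_add_card_useful (A i) (B i)
  rw [sum_add_distrib] at h2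
  linarith

end Greedy

/-- there is a deterministic online goods algorithm which, for submodular
binary valuations, maintains at every round a non-wasteful allocation that is
`1/2`-EF1, `1/2`-MMS and `1/2`-max-USW. -/
theorem goods_submodularBinary_half :
    ∃ alg : (n : ℕ) → GoodsAlg n,
      ∀ (n : ℕ) (v : Fin n → Finset ℕ → ℝ),
        (∀ i, SubmodularBinary (v i)) →
        ∀ k : ℕ,
          NonWasteful n v (Finset.range k) (runGoods (alg n) v k) ∧
          EF1Goods n (1 / 2) v (runGoods (alg n) v k) ∧
          MMSGoods n (1 / 2) v (Finset.range k) (runGoods (alg n) v k) ∧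
          MaxUSW n (1 / 2) v (Finset.range k) (runGoods (alg n) v k) := by
  refine ⟨greedyAlg, fun n v hv k => ?_⟩
  rw [runGoods_greedyAlg]
  have h := balanced_greedy hv k
  exact ⟨h.nonWasteful hv, h.ef1Goods hv, h.mmsGoods hv, h.maxUSW hv⟩

end OnlineFair
end

section
/- For every ε ∈ (0, 1/2] and every deterministic online algorithm for goods, there exists a goods instance with two agents having identical submodular binary valuation functions such that the final allocation A^t produced by the algorithm is not non-wasteful, or is neither (1/2+ε)-EF1 nor (1/2+ε)-MMS. In particular, for submodular binary valuations no deterministic online algorithm can achieve (1/2+ε)-EF1 or (1/2+ε)-MMS together with non-wastefulness for any ε > 0. -/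
open Finset

namespace OnlineFair

/-- The map sending good `3` to good `p` and fixing every other good. -/
def copyMap (p x : ℕ) : ℕ := if x = 3 then p else x

/-- The rank function of the matroid in which good `3` is parallel to good `p` and the goods are
otherwise independent. -/
def copyRank (p : ℕ) (S : Finset ℕ) : ℕ := #(S.image (copyMap p))

lemma submodularBinary_card_image (f : ℕ → ℕ) :
    SubmodularBinary fun S => (#(S.image f) : ℝ) := by
  refine ⟨⟨by simp, fun S T h => ?_⟩, fun X Y => ?_, fun X e => ?_⟩
  · beta_reduce
    exact_mod_cast card_le_card (image_subset_image h)
  · have h₁ := card_union_add_card_inter (X.image f) (Y.image f)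
    have h₂ := card_le_card (image_inter_subset f X Y)
    have h₃ : #((X ∪ Y).image f) + #((X ∩ Y).image f) ≤ #(X.image f) + #(Y.image f) := by
      rw [image_union]
      omega
    beta_reduce
    exact_mod_cast h₃
  · by_cases h : f e ∈ X.image f
    · left
      simp only [image_insert, insert_eq_of_mem h]
    · right
      simp only [image_insert, card_insert_of_notMem h]
      push_cast
      rfl

lemma copyRank_inter_range (p q : ℕ) {k : ℕ} (hk : k < 3) (S : Finset ℕ) :
    copyRank p (S ∩ range (k + 1)) = copyRank q (S ∩ range (k + 1)) := by
  unfold copyRank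
  congr 1
  refine image_congr fun x hx => ?_
  have hx3 : x ≠ 3 := by
    have := (mem_inter.1 (mem_coe.1 hx)).2
    rw [mem_range] at this
    omega
  simp [copyMap, hx3]

/-- The bundle of agent `i` after `k` rounds with decisions `d`. -/
def bundle {n : ℕ} (d : ℕ → Option (Fin n)) (k : ℕ) (i : Fin n) : Finset ℕ :=
  (range k).filter fun m => d m = some i

lemma runGoods_eq_bundle {n : ℕ} (alg : GoodsAlg n) (v : Fin n → Finset ℕ → ℝ)
    (d : ℕ → Option (Fin n)) {k : ℕ} (hd : ∀ m < k, alg m (restrictVal v m) = d m) :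
    runGoods alg v k = bundle d k := by
  induction k with
  | zero => rfl
  | succ k ih =>
    funext i
    have hk := hd k k.lt_succ_self
    have ih' := congrFun (ih fun m hm => hd m (hm.trans k.lt_succ_self)) i
    simp only [runGoods, hk]
    unfold bundle at ih' ⊢
    rw [range_add_one, filter_insert, ih']
    rcases h : d k with _ | j
    · simp
    · simp [eq_comm]

/-- The decisions of an algorithm in the first four rounds. -/
def decisions (a b c d : Option (Fin 2)) : ℕ → Option (Fin 2)
  | 0 => a
  | 1 => b
  | 2 => c
  | _ => d

/-- A condition under which `x` falls short of `α * y` for every `α > 1 / 2`. -/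
abbrev HalfShort (x y : ℕ) : Prop := 0 < y ∧ 2 * x ≤ y

lemma HalfShort.not_mul_le {x y : ℕ} (h : HalfShort x y) {ε : ℝ} (hε : 0 < ε) :
    ¬ (1 / 2 + ε) * (y : ℝ) ≤ x := by
  have h₁ : (0 : ℝ) < y := by exact_mod_cast h.1
  have h₂ : 2 * (x : ℝ) ≤ y := by exact_mod_cast h.2
  nlinarith [mul_pos hε h₁]

/-- A decidable certificate that an allocation to two agents with valuation `r` is wasteful. -/
abbrev Wasteful (r : Finset ℕ → ℕ) (t : ℕ) (A : Fin 2 → Finset ℕ) : Prop :=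
  (∃ i, ∃ e ∈ A i, r (A i) ≤ r ((A i).erase e)) ∨
    ∃ i, ∃ e ∈ range t, (∀ j, e ∉ A j) ∧ r (insert e (A i)) ≠ r (A i)

/-- A decidable certificate that an allocation to two agents with valuation `r` is not `α`-EF1 for
any `α > 1 / 2`. -/
abbrev EF1Short (r : Finset ℕ → ℕ) (A : Fin 2 → Finset ℕ) : Prop :=
  ∃ i j, (A j).Nonempty ∧ ∀ e ∈ A j, HalfShort (r (A i)) (r ((A j).erase e))

/-- A decidable certificate that an allocation to two agents with valuation `r` is not `α`-MMS for
any `α > 1 / 2`. -/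
abbrev MMSShort (r : Finset ℕ → ℕ) (t : ℕ) (A : Fin 2 → Finset ℕ) : Prop :=
  ∃ i, ∃ s ∈ (range t).powerset, HalfShort (r (A i)) (r s) ∧ HalfShort (r (A i)) (r (range t \ s))

lemma isPartition_sdiff {s T : Finset ℕ} (h : s ⊆ T) : IsPartition 2 T ![s, T \ s] := by
  refine ⟨⟨fun i => ?_, fun i j hij => ?_⟩, fun e he => ?_⟩
  · fin_cases i <;> simp [h]
  · fin_cases i <;> fin_cases j <;> simp [disjoint_sdiff, sdiff_disjoint] at hij ⊢
  · by_cases hs : e ∈ s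
    · exact ⟨0, by simpa using hs⟩
    · exact ⟨1, by simp [he, hs]⟩

lemma not_nonWasteful_and_fair {r : Finset ℕ → ℕ} {t : ℕ} {A : Fin 2 → Finset ℕ}
    (h : Wasteful r t A ∨ EF1Short r A ∧ MMSShort r t A) {ε : ℝ} (hε : 0 < ε) :
    ¬ (NonWasteful 2 (fun _ S => (r S : ℝ)) (range t) A ∧
      (EF1Goods 2 (1 / 2 + ε) (fun _ S => (r S : ℝ)) A ∨
        MMSGoods 2 (1 / 2 + ε) (fun _ S => (r S : ℝ)) (range t) A)) := by
  rintro ⟨⟨hpos, hdisc⟩, hfair⟩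
  rcases h with (⟨i, e, he, hle⟩ | ⟨i, e, he, hn, hne⟩) | ⟨⟨i, j, hj, hE⟩, k, s, hs, hs₁, hs₂⟩
  · have : r ((A i).erase e) < r (A i) := Nat.cast_lt.1 (hpos i e he)
    omega
  · exact hne (Nat.cast_injective (R := ℝ) (hdisc i e he hn))
  · rcases hfair with hfair | hfair
    · obtain ⟨e, he, hle⟩ := hfair i j hj
      exact (hE e he).not_mul_le hε hle
    · obtain ⟨j, hle⟩ := hfair k _ (isPartition_sdiff (mem_powerset.1 hs))
      fin_cases j
      · exact hs₁.not_mul_le hε hle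
      · exact hs₂.not_mul_le hε hle

/-- Either three independent goods already lead to failure, or one of them has a parallel copy
whose arrival does, however it is allocated. -/
lemma exists_failure (a b c : Option (Fin 2)) :
    (Wasteful (copyRank 0) 3 (bundle (decisions a b c none) 3) ∨
      EF1Short (copyRank 0) (bundle (decisions a b c none) 3) ∧
        MMSShort (copyRank 0) 3 (bundle (decisions a b c none) 3)) ∨
    ∃ p ∈ range 3, ∀ d, Wasteful (copyRank p) 4 (bundle (decisions a b c d) 4) ∨
      EF1Short (copyRank p) (bundle (decisions a b c d) 4) ∧
        MMSShort (copyRank p) 4 (bundle (decisions a b c d) 4) := by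
  revert a b c
  decide +kernel

/-- for submodular binary valuations, no deterministic online goods
algorithm achieves non-wastefulness together with `(1/2+ε)`-EF1 or `(1/2+ε)`-MMS,
even for two agents with identical valuations. -/
theorem goods_submodularBinary_upper_EF1_MMS :
    ∀ ε : ℝ, 0 < ε → ε ≤ 1 / 2 →
    ∀ alg : GoodsAlg 2,
    ∃ (t : ℕ) (v : Fin 2 → Finset ℕ → ℝ),
      v 0 = v 1 ∧ (∀ i, SubmodularBinary (v i)) ∧
      ¬ (NonWasteful 2 v (Finset.range t) (runGoods alg v t) ∧
          (EF1Goods 2 (1 / 2 + ε) v (runGoods alg v t) ∨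
            MMSGoods 2 (1 / 2 + ε) v (Finset.range t) (runGoods alg v t))) := by
  
  intro ε hε _ alg
  let v : ℕ → Fin 2 → Finset ℕ → ℝ := fun p _ S => (copyRank p S : ℝ)
  have hsub (p : ℕ) (i : Fin 2) : SubmodularBinary (v p i) :=
    submodularBinary_card_image (copyMap p)
  let dec (p k : ℕ) : Option (Fin 2) := alg k (restrictVal (v p) k)
  have hdec (p : ℕ) {k : ℕ} (hk : k < 3) : dec p k = dec 0 k := by
    have : restrictVal (v p) k = restrictVal (v 0) k := by
      funext i S
      exact congrArg (Nat.cast (R := ℝ)) (copyRank_inter_range p 0 hk S)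
    simp only [dec, this]
  rcases exists_failure (dec 0 0) (dec 0 1) (dec 0 2) with h | ⟨p, -, h⟩
  · refine ⟨3, v 0, rfl, hsub 0, ?_⟩
    rw [runGoods_eq_bundle alg (v 0) (decisions (dec 0 0) (dec 0 1) (dec 0 2) none)
      fun m hm => by interval_cases m <;> rfl]
    exact not_nonWasteful_and_fair h hε
  · refine ⟨4, v p, rfl, hsub p, ?_⟩
    rw [runGoods_eq_bundle alg (v p) (decisions (dec 0 0) (dec 0 1) (dec 0 2) (dec p 3))
      fun m hm => by
        interval_cases m
        · exact hdec p (by norm_num)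
        · exact hdec p (by norm_num)
        · exact hdec p (by norm_num)
        · rfl]
    exact not_nonWasteful_and_fair (h _) hε

end OnlineFair
end

section
/- For every ε ∈ (0, 1/2] and every deterministic online algorithm for goods, there exists a goods instance with two agents having submodular binary valuation functions such that the final allocation A^t produced by the algorithm is not non-wasteful, or is not (1/2+ε)-max-USW. In particular, for submodular binary valuations no deterministic online algorithm can achieve (1/2+ε)-max-USW and non-wastefulness for any ε > 0. -/
open Finset

namespace OnlineFair

/-- The rank-one valuation worth `1` on bundles meeting `T` and `0` elsewhere. -/
noncomputable def hitVal (T S : Finset ℕ) : ℝ :=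
  if (S ∩ T).Nonempty then 1 else 0

theorem hitVal_of_mem {T S : Finset ℕ} {e : ℕ} (hS : e ∈ S) (hT : e ∈ T) : hitVal T S = 1 :=
  if_pos ⟨e, mem_inter.2 ⟨hS, hT⟩⟩

theorem hitVal_le_one (T S : Finset ℕ) : hitVal T S ≤ 1 := by
  unfold hitVal
  split_ifs <;> norm_num

theorem hitVal_mono (T : Finset ℕ) {S S' : Finset ℕ} (h : S ⊆ S') :
    hitVal T S ≤ hitVal T S' := by
  unfold hitVal
  have hne : (S ∩ T).Nonempty → (S' ∩ T).Nonempty :=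
    fun hn => hn.mono (inter_subset_inter_right h)
  split_ifs <;> first | tauto | norm_num

theorem submodularBinary_hitVal (T : Finset ℕ) : SubmodularBinary (hitVal T) := by
  refine ⟨⟨by simp [hitVal], fun _ _ => hitVal_mono T⟩, fun X Y => ?_, fun X e => ?_⟩
  · have hX := hitVal_mono T (inter_subset_left : X ∩ Y ⊆ X)
    have hY := hitVal_mono T (inter_subset_right : X ∩ Y ⊆ Y)
    have hU : hitVal T (X ∪ Y) ≤ max (hitVal T X) (hitVal T Y) := by
      by_cases h : ((X ∪ Y) ∩ T).Nonempty
      · obtain ⟨e, he⟩ := h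
        obtain ⟨heXY, heT⟩ := mem_inter.1 he
        rcases mem_union.1 heXY with h | h
        · exact (hitVal_le_one _ _).trans (le_max_of_le_left (hitVal_of_mem h heT).ge)
        · exact (hitVal_le_one _ _).trans (le_max_of_le_right (hitVal_of_mem h heT).ge)
      · refine le_max_of_le_left ?_
        rw [hitVal, if_neg h]
        unfold hitVal
        split_ifs <;> norm_num
    rcases le_max_iff.1 hU with h | h <;> linarith
  · have h := hitVal_mono T (subset_insert e X)
    unfold hitVal at h ⊢
    split_ifs at h ⊢ <;> norm_num at *

theorem restrictVal_hitVal_zero {n : ℕ} (T : Fin n → Finset ℕ) (hT : ∀ i, 0 ∈ T i) :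
    restrictVal (fun i => hitVal (T i)) 0 = fun _ => hitVal {0} := by
  funext i S
  have h : S ∩ range (0 + 1) ∩ T i = S ∩ {0} := by
    ext e
    simp only [mem_inter, mem_range, mem_singleton]
    constructor
    · rintro ⟨⟨hS, he⟩, -⟩
      exact ⟨hS, by omega⟩
    · rintro ⟨hS, rfl⟩
      exact ⟨⟨hS, by omega⟩, hT i⟩
  simp only [restrictVal, hitVal, h]

theorem runGoods_subset_insert {n : ℕ} (alg : GoodsAlg n) (v : Fin n → Finset ℕ → ℝ) (k : ℕ)
    (i : Fin n) : runGoods alg v (k + 1) i ⊆ insert k (runGoods alg v k i) := by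
  simp only [runGoods]
  split
  · split_ifs
    · exact Subset.rfl
    · exact subset_insert _ _
  · exact subset_insert _ _

/-- for submodular binary valuations, no deterministic online goods
algorithm achieves non-wastefulness together with `(1/2+ε)`-max-USW. -/
theorem goods_submodularBinary_upper_USW :
    ∀ ε : ℝ, 0 < ε → ε ≤ 1 / 2 →
    ∀ alg : GoodsAlg 2,
    ∃ (t : ℕ) (v : Fin 2 → Finset ℕ → ℝ),
      (∀ i, SubmodularBinary (v i)) ∧
      ¬ (NonWasteful 2 v (Finset.range t) (runGoods alg v t) ∧
          MaxUSW 2 (1 / 2 + ε) v (Finset.range t) (runGoods alg v t)) := by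
  intro ε hε _ alg
  cases hd : alg 0 (fun _ => hitVal {0}) with
  | none =>
    refine ⟨1, fun _ => hitVal {0}, fun _ => submodularBinary_hitVal _, fun ⟨_, hU⟩ => ?_⟩
    have hA : runGoods alg (fun _ => hitVal {0}) 1 = fun _ => ∅ := by
      simp only [runGoods, restrictVal_hitVal_zero (fun _ => {0}) (by simp), hd]
    rw [hA] at hU
    have h := hU (fun i => if i = 0 then {0} else ∅) ⟨by decide, by decide⟩
    rw [Fin.sum_univ_two, Fin.sum_univ_two] at h
    norm_num [hitVal] at h
    linarith
  | some j =>
    set T : Fin 2 → Finset ℕ := fun i => if i = j then {0, 1} else {0} with hT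
    have hT0 : ∀ i, 0 ∈ T i := by
      intro i
      simp only [hT]
      split_ifs <;> simp
    refine ⟨2, fun i => hitVal (T i), fun _ => submodularBinary_hitVal _, fun ⟨_, hU⟩ => ?_⟩
    have hother : ∀ i, i ≠ j → hitVal (T i) (runGoods alg (fun i => hitVal (T i)) 2 i) = 0 := by
      intro i hi
      have hA : runGoods alg (fun i => hitVal (T i)) 1 i = ∅ := by
        simp only [runGoods, restrictVal_hitVal_zero T hT0, hd, if_neg hi]
      have hsub := runGoods_subset_insert alg (fun i => hitVal (T i)) 1 i
      rw [hA] at hsub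
      refine if_neg ?_
      rintro ⟨e, he⟩
      simp only [hT, if_neg hi, mem_inter, mem_singleton] at he
      have := hsub he.1
      simp [he.2] at this
    have halg : ∑ i, hitVal (T i) (runGoods alg (fun i => hitVal (T i)) 2 i) ≤ 1 := by
      rw [Finset.sum_eq_single j (fun i _ hi => hother i hi) (by simp)]
      exact hitVal_le_one _ _
    have hB : IsAlloc 2 (range 2) (fun i => if i = j then {1} else {0}) := by
      clear * -
      revert j
      unfold IsAlloc
      decide
    have h := hU _ hB
    have hopt : ∑ i, hitVal (T i) (if i = j then {1} else {0}) = 2 := by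
      have hone : ∀ i, hitVal (T i) (if i = j then {1} else {0}) = 1 := by
        intro i
        by_cases hi : i = j
        · exact hitVal_of_mem (e := 1) (by simp [hi]) (by simp [hT, hi])
        · exact hitVal_of_mem (e := 0) (by simp [hi]) (hT0 i)
      simp [hone]
    simp only [hopt] at h
    linarith

end OnlineFair
end

section
/- For all α ∈ (0,1], γ ∈ (0,1] and every deterministic online algorithm for goods, there exists a goods instance with two agents having additive bi-valued valuation functions such that the final allocation A^t produced by the algorithm is not non-wasteful, or fails both α-EF1 and α-MMS, or is not γ-max-USW. In particular, no deterministic online algorithm can compute a non-wasteful allocation that is α-EF1 or α-MMS and simultaneously γ-max-USW for any α, γ > 0, even for two agents with additive bi-valued valuations. -/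
open Finset

namespace OnlineFair

/-- The additive profile giving every item value `1` to every agent, except that agent `p`
values each item other than item `0` at `L`. -/
def spikeProfile (L : ℝ) (p : Fin 2) : Fin 2 → Finset ℕ → ℝ :=
  fun i S => ∑ e ∈ S, if i = p ∧ e ≠ 0 then L else 1

theorem spikeProfile_additive (L : ℝ) (p i : Fin 2) : AdditiveVal (spikeProfile L p i) := by
  intro S
  simp [spikeProfile]

theorem spikeProfile_biValued {L : ℝ} (hL : 1 ≤ L) (p i : Fin 2) :
    BiValuedVal (spikeProfile L p i) := by
  refine ⟨1, L, one_pos, hL, fun e => ?_⟩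
  by_cases h : i = p ∧ e ≠ 0
  · right; simp [spikeProfile, h]
  · left; simp only [spikeProfile, sum_singleton, if_neg h]

/-- After the first round, the profile reveals nothing about `L` and `p`. -/
theorem restrictVal_spikeProfile_zero (L : ℝ) (p : Fin 2) :
    restrictVal (spikeProfile L p) 0 = fun _ S => ((S ∩ range 1).card : ℝ) := by
  funext i S
  simp only [restrictVal, spikeProfile, zero_add, card_eq_sum_ones, Nat.cast_sum, Nat.cast_one]
  refine sum_congr rfl fun e he => if_neg ?_
  simp at he
  simp [he.2]

/-- A non-wasteful allocation discards no item that every agent values positively on top of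
her bundle. -/
theorem NonWasteful.exists_mem {n : ℕ} [NeZero n] {v : Fin n → Finset ℕ → ℝ} {T : Finset ℕ}
    {A : Fin n → Finset ℕ} (h : NonWasteful n v T A) {e : ℕ} (he : e ∈ T)
    (hpos : ∀ i, e ∉ A i → v i (A i) < v i (insert e (A i))) : ∃ i, e ∈ A i := by
  by_contra! hne
  exact (hpos 0 (hne 0)).ne' (h.2 0 e he hne)

theorem spikeProfile_lt_insert {L : ℝ} (hL : 1 ≤ L) (p i : Fin 2) {S : Finset ℕ} {e : ℕ}
    (he : e ∉ S) : spikeProfile L p i S < spikeProfile L p i (insert e S) := by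
  simp only [spikeProfile, sum_insert he]
  split_ifs <;> linarith

/-- Giving both of the first two items to `p` leaves the other agent with nothing, which violates
every positive approximation of EF1 and of MMS. -/
theorem spikeProfile_unfair {L α : ℝ} (hα : 0 < α) {p q : Fin 2} (hqp : q ≠ p)
    {A : Fin 2 → Finset ℕ} (hp : A p = {0, 1}) (hq : A q = ∅) :
    ¬ (EF1Goods 2 α (spikeProfile L p) A ∨ MMSGoods 2 α (spikeProfile L p) (range 2) A) := by
  rintro (h | h)
  · obtain ⟨e, he, h⟩ := h q p (by simp [hp])
    have hcard : ((A p).erase e).card = 1 := by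
      rw [card_erase_of_mem he, hp]
      rfl
    simp [spikeProfile, hqp, hq, hcard] at h
    linarith
  · obtain ⟨j, h⟩ := h q (fun i => {i.val})
      ⟨⟨by simp, fun i j hij => by simpa [Fin.ext_iff] using hij⟩, fun e he => by
        simp only [mem_range] at he
        exact ⟨⟨e, he⟩, by simp⟩⟩
    simp [spikeProfile, hqp, hq] at h
    linarith

/-- Giving item `0` to `p` and item `1` to the other agent is inefficient when `L` is large. -/
theorem spikeProfile_inefficient {L γ : ℝ} (hL : 2 < γ * L) {p q : Fin 2} (hqp : q ≠ p)
    {A : Fin 2 → Finset ℕ} (hp : A p = {0}) (hq : A q = {1}) :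
    ¬ MaxUSW 2 γ (spikeProfile L p) (range 2) A := by
  intro h
  have hsum (f : Fin 2 → ℝ) : ∑ i, f i = f p + f q := by
    rw [← sum_pair hqp.symm]
    congr
    ext i
    simp
    omega
  have h := h (fun i => if i = p then {1} else ∅) ⟨fun i => by
    dsimp only
    split_ifs <;> simp, fun i j hij => by
    dsimp only
    split_ifs with hi hj
    · exact absurd (hi.trans hj.symm) hij
    all_goals simp⟩
  rw [hsum, hsum] at h
  simp [spikeProfile, hqp, hp, hq] at h
  linarith

/-- for two agents with additive bi-valued valuations, no deterministic
online goods algorithm computes a non-wasteful allocation that is `α`-EF1 or `α`-MMS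
and simultaneously `γ`-max-USW, for any `α, γ ∈ (0,1]`. -/
theorem goods_biValued_no_fair_and_efficient :
    ∀ α : ℝ, 0 < α → α ≤ 1 → ∀ γ : ℝ, 0 < γ → γ ≤ 1 →
    ∀ alg : GoodsAlg 2,
    ∃ (t : ℕ) (v : Fin 2 → Finset ℕ → ℝ),
      (∀ i, AdditiveVal (v i)) ∧ (∀ i, BiValuedVal (v i)) ∧
      ¬ (NonWasteful 2 v (Finset.range t) (runGoods alg v t) ∧
          (EF1Goods 2 α v (runGoods alg v t) ∨
            MMSGoods 2 α v (Finset.range t) (runGoods alg v t)) ∧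
          MaxUSW 2 γ v (Finset.range t) (runGoods alg v t)) := by
  intro α hα _ γ hγ hγ1 alg
  set L : ℝ := 3 / γ with hLdef
  have hγL : γ * L = 3 := by rw [hLdef]; field_simp
  have hL : 1 ≤ L := by rw [hLdef, one_le_div hγ]; linarith
  rcases h0 : alg 0 (fun _ S => ((S ∩ range 1).card : ℝ)) with _ | p
  · refine ⟨1, spikeProfile L 0, spikeProfile_additive L 0, spikeProfile_biValued hL 0, ?_⟩
    rintro ⟨hnw, -, -⟩
    obtain ⟨i, hi⟩ := hnw.exists_mem (e := 0) (by simp)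
      fun i hi => spikeProfile_lt_insert hL 0 i hi
    simp only [runGoods, restrictVal_spikeProfile_zero, h0, notMem_empty] at hi
  · refine ⟨2, spikeProfile L p, spikeProfile_additive L p, spikeProfile_biValued hL p, ?_⟩
    rintro ⟨hnw, hfair, husw⟩
    obtain ⟨q, hqp⟩ := exists_ne p
    have h1 (i : Fin 2) : runGoods alg (spikeProfile L p) 1 i = if i = p then {0} else ∅ := by
      simp only [runGoods, restrictVal_spikeProfile_zero, h0, insert_empty_eq]
    rcases hr : alg 1 (restrictVal (spikeProfile L p) 1) with _ | r
    · obtain ⟨i, hi⟩ := hnw.exists_mem (e := 1) (by simp)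
        fun i hi => spikeProfile_lt_insert hL p i hi
      rw [runGoods] at hi
      simp only [hr, h1] at hi
      split_ifs at hi <;> simp at hi
    · have h2 (i : Fin 2) : runGoods alg (spikeProfile L p) 2 i =
          if i = r then insert 1 (if i = p then {0} else ∅) else if i = p then {0} else ∅ := by
        rw [runGoods]
        simp only [hr, h1]
      by_cases hrp : r = p
      · subst hrp
        exact spikeProfile_unfair hα hqp (by simp [h2, pair_comm]) (by simp [h2, hqp]) hfair
      · obtain rfl : r = q := by omega
        exact spikeProfile_inefficient (by linarith) hqp (by simp [h2, hqp.symm])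
          (by simp [h2, hqp]) husw

end OnlineFair
end

section
/- For every γ ∈ (0,1] and every deterministic online algorithm for goods, there exists a goods instance with two agents, where agent 1 has an additive binary valuation function and agent 2 has an additive bi-valued valuation function, such that the final allocation A^t produced by the algorithm is not non-wasteful, or fails both 1-EF1 and 1-MMS, or is not γ-max-USW. In particular, no deterministic online algorithm can compute a non-wasteful allocation that is EF1 or MMS and simultaneously γ-max-USW for any γ > 0 in this setting. -/
open Finset

namespace OnlineFair

/-- The profile in which agent `0` values every good at `1`, while agent `1` values good `0`
at `M` and every other good at `M ^ 2`. -/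
noncomputable def adversarialProfile (M : ℝ) : Fin 2 → Finset ℕ → ℝ :=
  ![fun S => ∑ _e ∈ S, 1, fun S => ∑ e ∈ S, if e = 0 then M else M ^ 2]

lemma adversarialProfile_zero (M : ℝ) (S : Finset ℕ) :
    adversarialProfile M 0 S = ∑ _e ∈ S, (1 : ℝ) := rfl

lemma adversarialProfile_one (M : ℝ) (S : Finset ℕ) :
    adversarialProfile M 1 S = ∑ e ∈ S, if e = 0 then M else M ^ 2 := rfl

lemma runGoods_succ {n : ℕ} (alg : GoodsAlg n) (v : Fin n → Finset ℕ → ℝ) (k : ℕ) (i : Fin n) :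
    runGoods alg v (k + 1) i =
      if alg k (restrictVal v k) = some i then insert k (runGoods alg v k i)
      else runGoods alg v k i := by
  rw [runGoods]
  cases alg k (restrictVal v k) with
  | none => simp
  | some j => simp [eq_comm]

lemma isAlloc_all_to_one (T : Finset ℕ) : IsAlloc 2 T ![∅, T] := by
  simp [IsAlloc, Fin.forall_fin_two]

lemma not_fair_of_all_to_one (M : ℝ) {A : Fin 2 → Finset ℕ} (h0 : A 0 = ∅)
    (h1 : A 1 = Finset.range 2) :
    ¬ (EF1Goods 2 1 (adversarialProfile M) A ∨
      MMSGoods 2 1 (adversarialProfile M) (Finset.range 2) A) := by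
  rintro (h | h)
  · obtain ⟨e, he, hle⟩ := h 0 1 (by simp [h1])
    rw [h0, h1] at hle
    rw [h1] at he
    norm_num [adversarialProfile_zero, Finset.card_erase_of_mem he] at hle
  · obtain ⟨j, hle⟩ := h 0 ![{0}, {1}] (by
      simp [IsPartition, IsAlloc, Complete, Fin.forall_fin_two, Fin.exists_fin_two]
      omega)
    rw [h0] at hle
    fin_cases j <;> norm_num [adversarialProfile_zero] at hle

/-- for two agents, one with an additive binary valuation and one with an
additive bi-valued valuation, no deterministic online goods algorithm computes a
non-wasteful allocation that is EF1 or MMS and simultaneously `γ`-max-USW. -/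
theorem goods_binary_biValued_no_efficiency :
    ∀ γ : ℝ, 0 < γ → γ ≤ 1 →
    ∀ alg : GoodsAlg 2,
    ∃ (t : ℕ) (v : Fin 2 → Finset ℕ → ℝ),
      AdditiveVal (v 0) ∧ BinaryVal (v 0) ∧ AdditiveVal (v 1) ∧ BiValuedVal (v 1) ∧
      ¬ (NonWasteful 2 v (Finset.range t) (runGoods alg v t) ∧
          (EF1Goods 2 1 v (runGoods alg v t) ∨
            MMSGoods 2 1 v (Finset.range t) (runGoods alg v t)) ∧
          MaxUSW 2 γ v (Finset.range t) (runGoods alg v t)) := by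
  intro γ hγ hγ1 alg
  set M : ℝ := 2 / γ with hM
  have hγM : γ * M = 2 := by rw [hM]; field_simp
  have hM2 : 2 ≤ M := by rw [hM, le_div_iff₀ hγ]; linarith
  have hγM2 : γ * M ^ 2 = 2 * M := by rw [pow_two, ← mul_assoc, hγM]
  set v := adversarialProfile M with hv
  have hadd : AdditiveVal (v 0) ∧ BinaryVal (v 0) ∧ AdditiveVal (v 1) ∧ BiValuedVal (v 1) := by
    refine ⟨fun S => ?_, fun e => ?_, fun S => ?_, M, M ^ 2, by linarith, by nlinarith,
      fun e => ?_⟩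
    · simp [hv, adversarialProfile_zero]
    · simp [hv, adversarialProfile_zero]
    · simp [hv, adversarialProfile_one]
    · rw [hv, adversarialProfile_one, Finset.sum_singleton]
      split_ifs <;> simp
  suffices h : ∃ t, ¬ ((EF1Goods 2 1 v (runGoods alg v t) ∨
      MMSGoods 2 1 v (Finset.range t) (runGoods alg v t)) ∧
      MaxUSW 2 γ v (Finset.range t) (runGoods alg v t)) by
    obtain ⟨t, ht⟩ := h
    exact ⟨t, v, hadd.1, hadd.2.1, hadd.2.2.1, hadd.2.2.2, fun h => ht h.2⟩
  have hrun0 : ∀ i, runGoods alg v 0 i = ∅ := fun _ => rfl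
  by_cases hfirst : alg 0 (restrictVal v 0) = some 1
  · refine ⟨2, fun ⟨hfair, husw⟩ => ?_⟩
    by_cases hsecond : alg 1 (restrictVal v 1) = some 1
    · refine not_fair_of_all_to_one M ?_ ?_ hfair
      · simp [runGoods_succ, hrun0, hfirst, hsecond]
      · simp [runGoods_succ, hrun0, hfirst, hsecond]
        decide
    · have h := husw _ (isAlloc_all_to_one _)
      simp only [Fin.sum_univ_two, runGoods_succ, hrun0, hfirst, hsecond] at h
      simp [hv, adversarialProfile_zero, adversarialProfile_one, Finset.sum_range_succ] at h
      split_ifs at h <;> simp at h <;> nlinarith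
  · refine ⟨1, fun ⟨_, husw⟩ => ?_⟩
    have h := husw _ (isAlloc_all_to_one _)
    simp only [Fin.sum_univ_two, runGoods_succ, hrun0, hfirst] at h
    simp [hv, adversarialProfile_zero, adversarialProfile_one] at h
    split_ifs at h <;> simp at h <;> nlinarith

end OnlineFair
end

section
/- For every α ≥ 1 and every deterministic online algorithm for chores, there exists a chores instance with n = 2 agents having additive tri-valued cost functions such that the final complete allocation A^t produced by the algorithm is not α-EF1. In particular, no deterministic online algorithm can compute a complete allocation guaranteeing α-EF1 for any α ≥ 1, even for two agents with additive tri-valued cost functions. -/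
open Finset

namespace OnlineFair

/-- The additive set function with singleton values `w`. -/
def additiveOf (w : ℕ → ℝ) (S : Finset ℕ) : ℝ := ∑ e ∈ S, w e

/-- Adversarial chore costs against an algorithm that gives the first chore to agent `p`. -/
def adversaryCost (α : ℝ) (p i : Fin 2) (e : ℕ) : ℝ :=
  if e = 0 then 2 * α else if i = p then (if e = 1 then 1 else 2 * α) else 4 * α ^ 2

lemma additiveVal_additiveOf (w : ℕ → ℝ) : AdditiveVal (additiveOf w) := by
  intro S
  simp [additiveOf]

lemma triValuedVal_adversaryCost {α : ℝ} (hα : 1 ≤ α) (p i : Fin 2) :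
    TriValuedVal (additiveOf (adversaryCost α p i)) := by
  refine ⟨1, 2 * α, 4 * α ^ 2, one_pos, by linarith, by nlinarith, fun e => ?_⟩
  simp only [additiveOf, sum_singleton, adversaryCost]
  split_ifs <;> simp

lemma restrictVal_adversaryCost_zero (α : ℝ) (p q : Fin 2) :
    restrictVal (fun i => additiveOf (adversaryCost α p i)) 0 =
      restrictVal (fun i => additiveOf (adversaryCost α q i)) 0 := by
  funext i S
  refine sum_congr rfl fun e he => ?_
  have : e = 0 := by simpa using (mem_inter.mp he).2
  simp [adversaryCost, this]

lemma not_EF1Chores_of_forall_lt {α : ℝ} {c : Fin 2 → Finset ℕ → ℝ} {A : Fin 2 → Finset ℕ}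
    (i j : Fin 2) (hA : (A i).Nonempty) (h : ∀ e ∈ A i, α * c i (A j) < c i ((A i).erase e)) :
    ¬ EF1Chores 2 α c A := fun hEF => by
  obtain ⟨e, he, hle⟩ := hEF i j hA
  exact (h e he).not_ge hle

/-- for additive tri-valued cost functions and two agents, no
deterministic online chores algorithm guarantees an `α`-EF1 complete allocation,
for any `α ≥ 1`. -/
theorem chores_triValued_no_EF1 :
    ∀ α : ℝ, 1 ≤ α →
    ∀ alg : ChoresAlg 2,
    ∃ (t : ℕ) (c : Fin 2 → Finset ℕ → ℝ),
      (∀ i, AdditiveVal (c i)) ∧ (∀ i, TriValuedVal (c i)) ∧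
      ¬ EF1Chores 2 α c (runChores alg c t) := by
  intro α hα alg
  obtain ⟨p, hp⟩ : ∃ p, alg 0 (restrictVal (fun i => additiveOf (adversaryCost α p i)) 0) = p :=
    ⟨_, congrArg (alg 0) (restrictVal_adversaryCost_zero α _ 0)⟩
  obtain ⟨q, hqp⟩ : ∃ q : Fin 2, q ≠ p := exists_ne p
  have hpq := hqp.symm
  have eq_or (r : Fin 2) : r = p ∨ r = q := by omega
  set c : Fin 2 → Finset ℕ → ℝ := fun i => additiveOf (adversaryCost α p i) with hc
  suffices ∃ t, ¬ EF1Chores 2 α c (runChores alg c t) by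
    obtain ⟨t, ht⟩ := this
    exact ⟨t, c, fun i => additiveVal_additiveOf _, fun i => triValuedVal_adversaryCost hα p i, ht⟩
  rcases eq_or (alg 1 (restrictVal c 1)) with h1 | h1
  · have hAp : runChores alg c 2 p = {1, 0} := by simp [runChores, hp, h1]
    have hAq : runChores alg c 2 q = ∅ := by simp [runChores, hp, h1, hqp]
    refine ⟨2, not_EF1Chores_of_forall_lt p q (by simp [hAp]) ?_⟩
    rw [hAp, hAq]
    intro e he
    obtain rfl | rfl : e = 1 ∨ e = 0 := by simpa using he
    · rw [show ({1, 0} : Finset ℕ).erase 1 = {0} by decide]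
      simp [hc, additiveOf, adversaryCost]
      linarith
    · rw [show ({1, 0} : Finset ℕ).erase 0 = {1} by decide]
      simp [hc, additiveOf, adversaryCost]
  rcases eq_or (alg 2 (restrictVal c 2)) with h2 | h2
  · have hAp : runChores alg c 3 p = {2, 0} := by simp [runChores, hp, h1, h2, hpq]
    have hAq : runChores alg c 3 q = {1} := by simp [runChores, hp, h1, h2, hqp]
    refine ⟨3, not_EF1Chores_of_forall_lt p q (by simp [hAp]) ?_⟩
    rw [hAp, hAq]
    intro e he
    obtain rfl | rfl : e = 2 ∨ e = 0 := by simpa using he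
    · rw [show ({2, 0} : Finset ℕ).erase 2 = {0} by decide]
      simp [hc, additiveOf, adversaryCost]
      linarith
    · rw [show ({2, 0} : Finset ℕ).erase 0 = {2} by decide]
      simp [hc, additiveOf, adversaryCost]
      linarith
  · have hAp : runChores alg c 3 p = {0} := by simp [runChores, hp, h1, h2, hpq]
    have hAq : runChores alg c 3 q = {2, 1} := by simp [runChores, hp, h1, h2, hqp]
    refine ⟨3, not_EF1Chores_of_forall_lt q p (by simp [hAq]) ?_⟩
    rw [hAp, hAq]
    intro e he
    obtain rfl | rfl : e = 2 ∨ e = 1 := by simpa using he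
    · rw [show ({2, 1} : Finset ℕ).erase 2 = {1} by decide]
      simp [hc, additiveOf, adversaryCost, hqp]
      nlinarith
    · rw [show ({2, 1} : Finset ℕ).erase 1 = {2} by decide]
      simp [hc, additiveOf, adversaryCost, hqp]
      nlinarith

end OnlineFair
end

section
/- There exists a deterministic online algorithm for chores such that, for every chores instance with n agents having additive binary cost functions and for every round k, the complete allocation A^k it produces is 1-EF1, 1-MMS, and 1-min-USC (i.e., it minimizes utilitarian social cost among complete allocations of the arrived chores). -/
open Finset

namespace OnlineFair

/-- Every agent has a nonzero cost for the chore `e`. -/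
def Costly {n : ℕ} (c : Fin n → Finset ℕ → ℝ) (e : ℕ) : Prop :=
  ∀ i, c i {e} ≠ 0

open Classical in
/-- The number of chores in `S` with a nonzero cost for `v`. -/
noncomputable def costCount (v : Finset ℕ → ℝ) (S : Finset ℕ) : ℕ :=
  #{e ∈ S | v {e} ≠ 0}

open Classical in
/-- The number of chores in `S` costly for every agent. -/
noncomputable def costlyCount {n : ℕ} (c : Fin n → Finset ℕ → ℝ) (S : Finset ℕ) : ℕ :=
  #{e ∈ S | Costly c e}

open Classical in
/-- A chore that is free for some agent goes to such an agent; the remaining chores are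
distributed in round-robin order. -/
noncomputable def roundRobinAlg (n : ℕ) : ChoresAlg (n + 1) := fun k w =>
  if h : ∃ i, w i {k} = 0 then h.choose
  else Fin.ofNat (n + 1) (costlyCount w (range k))

/-- The number of costly chores that agent `i` holds once `m` of them have been distributed
in round-robin order among `n + 1` agents. -/
def roundRobinLoad (n m : ℕ) (i : Fin (n + 1)) : ℕ :=
  m / (n + 1) + if (i : ℕ) < m % (n + 1) then 1 else 0

theorem roundRobinLoad_le_succ (n m : ℕ) (i j : Fin (n + 1)) :
    roundRobinLoad n m i ≤ roundRobinLoad n m j + 1 := by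
  unfold roundRobinLoad
  split_ifs <;> omega

theorem sum_roundRobinLoad (n m : ℕ) : ∑ i, roundRobinLoad n m i = m := by
  have hr : m % (n + 1) < n + 1 := Nat.mod_lt _ n.succ_pos
  have hm := Nat.div_add_mod m (n + 1)
  simp only [roundRobinLoad, sum_add_distrib, sum_const, card_univ, Fintype.card_fin,
    smul_eq_mul, sum_boole, Nat.cast_id]
  rw [Fin.card_filter_val_lt]
  rw [min_eq_right hr.le]
  exact hm

theorem roundRobinLoad_succ (n m : ℕ) (i : Fin (n + 1)) :
    roundRobinLoad n (m + 1) i =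
      roundRobinLoad n m i + if i = Fin.ofNat (n + 1) m then 1 else 0 := by
  have hr : m % (n + 1) < n + 1 := Nat.mod_lt _ n.succ_pos
  have hm := Nat.div_add_mod m (n + 1)
  have hi := i.isLt
  have hiff : i = Fin.ofNat (n + 1) m ↔ (i : ℕ) = m % (n + 1) := by
    rw [Fin.ext_iff, Fin.val_ofNat]
  simp only [roundRobinLoad, hiff]
  generalize m / (n + 1) = q at hm
  generalize m % (n + 1) = r at hr hm
  subst hm
  rcases Nat.lt_or_ge r n with h | h
  · have h1 : ((n + 1) * q + r + 1) / (n + 1) = q := by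
      rw [add_assoc, Nat.mul_add_div n.succ_pos, Nat.div_eq_of_lt (by omega), add_zero]
    have h2 : ((n + 1) * q + r + 1) % (n + 1) = r + 1 := by
      rw [add_assoc, Nat.mul_add_mod, Nat.mod_eq_of_lt (by omega)]
    rw [h1, h2]
    split_ifs <;> omega
  · obtain rfl : r = n := by omega
    have h0 : (r + 1) * q + r + 1 = (r + 1) * (q + 1) := by ring
    rw [h0, Nat.mul_div_cancel_left _ r.succ_pos, Nat.mul_mod_right]
    split_ifs <;> omega

/-- If `m` chores are split into `n + 1` bundles, some bundle is at least as large as any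
given round-robin load. -/
theorem exists_roundRobinLoad_le {n m : ℕ} (i : Fin (n + 1)) (f : Fin (n + 1) → ℕ)
    (hf : m ≤ ∑ j, f j) : ∃ j, roundRobinLoad n m i ≤ f j := by
  by_contra! h
  have h1 : ∀ j, f j ≤ roundRobinLoad n m j := fun j => by
    have := h j
    have := roundRobinLoad_le_succ n m i j
    omega
  have h2 : ∑ j, f j < ∑ j, roundRobinLoad n m j :=
    sum_lt_sum (fun j _ => h1 j) ⟨i, mem_univ i, h i⟩
  rw [sum_roundRobinLoad] at h2
  omega

theorem AdditiveVal.eq_costCount {v : Finset ℕ → ℝ} (ha : AdditiveVal v) (hb : BinaryVal v)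
    (S : Finset ℕ) : v S = costCount v S := by
  classical
  rw [ha S, costCount, card_filter, Nat.cast_sum]
  refine sum_congr rfl fun e _ => ?_
  rcases hb e with h | h <;> simp [h]

theorem costlyCount_le_costCount {n : ℕ} (c : Fin n → Finset ℕ → ℝ) (i : Fin n)
    (S : Finset ℕ) : costlyCount c S ≤ costCount (c i) S := by
  classical
  exact card_le_card (monotone_filter_right S fun _ _ h => h i)

/-- In a complete allocation, the costly chores contribute to the total cost whichever agent
evaluates each bundle. -/
theorem costlyCount_le_sum {n : ℕ} {c : Fin n → Finset ℕ → ℝ} {T : Finset ℕ}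
    {B : Fin n → Finset ℕ} (hB : Complete n T B) (σ : Fin n → Fin n) :
    costlyCount c T ≤ ∑ j, costCount (c (σ j)) (B j) := by
  classical
  refine le_trans (card_le_card ?_) card_biUnion_le
  intro e he
  rw [mem_filter] at he
  obtain ⟨j, hj⟩ := hB e he.1
  exact mem_biUnion.2 ⟨j, mem_univ j, mem_filter.2 ⟨hj, he.2 (σ j)⟩⟩

theorem costlyCount_insert {n : ℕ} (c : Fin n → Finset ℕ → ℝ) {e : ℕ} {S : Finset ℕ}
    (he : e ∉ S) [Decidable (Costly c e)] :
    costlyCount c (insert e S) = costlyCount c S + if Costly c e then 1 else 0 := by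
  classical
  unfold costlyCount
  rw [filter_insert]
  split_ifs
  · rw [card_insert_of_notMem (by simp [he])]
  · rfl

theorem costlyCount_congr {n : ℕ} {c d : Fin n → Finset ℕ → ℝ} {S : Finset ℕ}
    (h : ∀ e ∈ S, ∀ i, c i {e} = d i {e}) : costlyCount c S = costlyCount d S := by
  classical
  unfold costlyCount
  congr 1
  exact filter_congr fun e he => forall_congr' fun i => by rw [h e he i]

theorem restrictVal_singleton {n : ℕ} (c : Fin n → Finset ℕ → ℝ) {k e : ℕ} (he : e ≤ k)
    (i : Fin n) : restrictVal c k i {e} = c i {e} := by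
  unfold restrictVal
  rw [inter_eq_left.2 (by simpa using Nat.lt_succ_of_le he)]

theorem roundRobinAlg_cost_eq_zero {n k : ℕ} {c : Fin (n + 1) → Finset ℕ → ℝ}
    (h : ¬ Costly c k) : c (roundRobinAlg n k (restrictVal c k)) {k} = 0 := by
  have h' : ∃ i, restrictVal c k i {k} = 0 := by
    simpa [Costly, restrictVal_singleton c le_rfl] using h
  rw [roundRobinAlg, dif_pos h', ← restrictVal_singleton c le_rfl]
  exact h'.choose_spec

theorem roundRobinAlg_of_costly {n k : ℕ} {c : Fin (n + 1) → Finset ℕ → ℝ}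
    (h : Costly c k) :
    roundRobinAlg n k (restrictVal c k) = Fin.ofNat (n + 1) (costlyCount c (range k)) := by
  have h' : ¬ ∃ i, restrictVal c k i {k} = 0 := by
    simpa [Costly, restrictVal_singleton c le_rfl] using h
  rw [roundRobinAlg, dif_neg h', costlyCount_congr fun e he i =>
    restrictVal_singleton c (mem_range.1 he).le i]

theorem runChores_succ {n : ℕ} (alg : ChoresAlg n) (c : Fin n → Finset ℕ → ℝ) (k : ℕ)
    (i : Fin n) : runChores alg c (k + 1) i =
      if i = alg k (restrictVal c k) then insert k (runChores alg c k i)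
      else runChores alg c k i := rfl

theorem runChores_subset_range {n : ℕ} (alg : ChoresAlg n) (c : Fin n → Finset ℕ → ℝ)
    (k : ℕ) (i : Fin n) : runChores alg c k i ⊆ range k := by
  induction k with
  | zero => simp [runChores]
  | succ k ih =>
    rw [runChores_succ, range_add_one]
    split_ifs
    · exact insert_subset_insert k ih
    · exact ih.trans (subset_insert k _)

theorem complete_runChores {n : ℕ} (alg : ChoresAlg n) (c : Fin n → Finset ℕ → ℝ)
    (k : ℕ) : Complete n (range k) (runChores alg c k) := by
  induction k with
  | zero => simp [Complete]
  | succ k ih =>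
    intro e he
    rw [range_add_one, mem_insert] at he
    rcases he with rfl | he
    · exact ⟨alg e (restrictVal c e), by simp [runChores]⟩
    · obtain ⟨i, hi⟩ := ih e he
      refine ⟨i, ?_⟩
      rw [runChores_succ]
      split_ifs
      · exact mem_insert_of_mem hi
      · exact hi

theorem costly_of_mem_runChores {n : ℕ} {c : Fin (n + 1) → Finset ℕ → ℝ} {k : ℕ}
    {i : Fin (n + 1)} {e : ℕ} (he : e ∈ runChores (roundRobinAlg n) c k i)
    (hc : c i {e} ≠ 0) : Costly c e := by
  induction k with
  | zero => simp [runChores] at he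
  | succ k ih =>
    rw [runChores_succ] at he
    split_ifs at he with hi
    · rcases mem_insert.1 he with rfl | he
      · by_contra h
        exact hc (hi ▸ roundRobinAlg_cost_eq_zero h)
      · exact ih he
    · exact ih he

theorem costCount_runChores {n : ℕ} (c : Fin (n + 1) → Finset ℕ → ℝ) (k : ℕ)
    (i : Fin (n + 1)) :
    costCount (c i) (runChores (roundRobinAlg n) c k i) =
      costlyCount c (runChores (roundRobinAlg n) c k i) := by
  classical
  unfold costCount costlyCount
  congr 1
  exact filter_congr fun e he => ⟨costly_of_mem_runChores he, fun h => h i⟩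

theorem costlyCount_runChores {n : ℕ} (c : Fin (n + 1) → Finset ℕ → ℝ) (k : ℕ)
    (i : Fin (n + 1)) :
    costlyCount c (runChores (roundRobinAlg n) c k i) =
      roundRobinLoad n (costlyCount c (range k)) i := by
  classical
  induction k with
  | zero => simp [runChores, costlyCount, roundRobinLoad]
  | succ k ih =>
    have hk : k ∉ runChores (roundRobinAlg n) c k i := fun h =>
      notMem_range_self (runChores_subset_range _ c k i h)
    rw [range_add_one, costlyCount_insert c notMem_range_self, runChores_succ]
    by_cases h : Costly c k
    · rw [roundRobinAlg_of_costly h, if_pos h, roundRobinLoad_succ, ← ih]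
      split_ifs with hi
      · rw [costlyCount_insert c hk, if_pos h]
      · rfl
    · rw [if_neg h, add_zero, ← ih]
      split_ifs with hi
      · rw [costlyCount_insert c hk, if_neg h, add_zero]
      · rfl

theorem exists_costCount_erase_le (v : Finset ℕ → ℝ) {S : Finset ℕ} (hS : S.Nonempty) :
    ∃ e ∈ S, costCount v (S.erase e) ≤ costCount v S - 1 := by
  classical
  by_cases h : ∃ e ∈ S, v {e} ≠ 0
  · obtain ⟨e, he, hv⟩ := h
    refine ⟨e, he, ?_⟩
    unfold costCount
    rw [filter_erase, card_erase_of_mem (mem_filter.2 ⟨he, hv⟩)]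
  · push Not at h
    obtain ⟨e, he⟩ := hS
    refine ⟨e, he, ?_⟩
    have h0 : costCount v (S.erase e) = 0 := by
      unfold costCount
      rw [card_eq_zero, filter_eq_empty_iff]
      exact fun x hx => not_not.2 (h x (mem_of_mem_erase hx))
    omega

/-- there is a deterministic online chores algorithm which, for additive
binary cost functions, maintains at every round a complete allocation that is EF1,
MMS and min-USC. -/
theorem chores_binary_positive :
    ∃ alg : (n : ℕ) → ChoresAlg (n + 1),
      ∀ (n : ℕ) (c : Fin (n + 1) → Finset ℕ → ℝ),
        (∀ i, AdditiveVal (c i)) → (∀ i, BinaryVal (c i)) →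
        ∀ k : ℕ,
          Complete (n + 1) (Finset.range k) (runChores (alg n) c k) ∧
          EF1Chores (n + 1) 1 c (runChores (alg n) c k) ∧
          MMSChores (n + 1) 1 c (Finset.range k) (runChores (alg n) c k) ∧
          MinUSC (n + 1) 1 c (Finset.range k) (runChores (alg n) c k) := by
  refine ⟨roundRobinAlg, fun n c ha hb k => ?_⟩
  have hcost : ∀ i S, c i S = costCount (c i) S := fun i => (ha i).eq_costCount (hb i)
  have hload : ∀ i, costCount (c i) (runChores (roundRobinAlg n) c k i) =
      roundRobinLoad n (costlyCount c (range k)) i := fun i =>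
    (costCount_runChores c k i).trans (costlyCount_runChores c k i)
  refine ⟨complete_runChores _ c k, fun i j hi => ?_, fun i B hB => ?_, fun B hB => ?_⟩
  · obtain ⟨e, he, hle⟩ := exists_costCount_erase_le (c i) hi
    refine ⟨e, he, ?_⟩
    rw [one_mul, hcost, hcost i (runChores _ c k j), Nat.cast_le]
    have h1 := roundRobinLoad_le_succ n (costlyCount c (range k)) i j
    rw [← hload i, ← costlyCount_runChores c k j] at h1
    have h2 := costlyCount_le_costCount c i (runChores (roundRobinAlg n) c k j)
    omega
  · obtain ⟨j, hj⟩ := exists_roundRobinLoad_le i _ (costlyCount_le_sum hB.2 fun _ => i)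
    refine ⟨j, ?_⟩
    rwa [one_mul, hcost, hcost i (B j), Nat.cast_le, hload]
  · simp only [one_mul, hcost, hload]
    rw [← Nat.cast_sum, ← Nat.cast_sum, Nat.cast_le, sum_roundRobinLoad]
    exact costlyCount_le_sum hB.2 id

end OnlineFair
end
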